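/- Let q be a complex number with 0 < |q| < 1, let λ be a nonzero complex number, and let f(x) = Σ_{k≥0} a_k x^k be a power series with radius of convergence R > 0. Define its q-Borel transform φ(ξ) := Σ_{k≥0} a_k q^{k(k−1)/2} ξ^k (an entire function). Then for every x with 0 < |x| < R and x ∉ {−λ q^m : m ∈ ℤ}, the q-Laplace transform Σ_{n∈ℤ} φ(λq^n)/θ_q(λq^n/x) converges and equals f(x); in particular the result is independent of λ. -/

import Mathlib

open Complex Filter Topology

noncomputable def qPochInt (q a : ℂ) (n : ℤ) : ℂ :=
  if 0 ≤ n then ∏ k ∈ Finset.range n.toNat, (1 - a * q ^ k)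
  else (∏ k ∈ Finset.range (-n).toNat, (1 - a * q ^ (-(k + 1 : ℤ))))⁻¹

noncomputable def qPochInf (q a : ℂ) : ℂ := ∏' k : ℕ, (1 - a * q ^ k)

noncomputable def thetaQ (q z : ℂ) : ℂ := ∑' n : ℤ, q ^ (n * (n - 1) / 2) * z ^ n

/-- Triangular exponents are additive up to a cross term. -/
lemma tri_add (m n : ℤ) : (m + n) * (m + n - 1) / 2 = m * (m - 1) / 2 + n * (n - 1) / 2 + m * n := by
  have h1 : ∀ n : ℤ, 2 * (n * (n - 1) / 2) = n * (n - 1) := fun n =>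
    Int.mul_ediv_cancel' (Int.even_mul_pred_self n).two_dvd
  have a1 := h1 m
  have a2 := h1 n
  have a3 := h1 (m + n)
  have : (m + n) * (m + n - 1) = m * (m - 1) + n * (n - 1) + 2 * (m * n) := by ring
  linarith

lemma tri_nat (k : ℕ) : ((k * (k - 1) / 2 : ℕ) : ℤ) = (k : ℤ) * ((k : ℤ) - 1) / 2 := by
  cases k with
  | zero => simp
  | succ k => push_cast; simp

lemma tri_succ (k : ℕ) : (k + 1) * (k + 1 - 1) / 2 = k * (k - 1) / 2 + k := by
  have h := tri_add (k : ℤ) 1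
  have h1 := tri_nat (k + 1)
  have h2 := tri_nat k
  push_cast at h1
  simp only [mul_one, sub_self, mul_zero, Int.zero_ediv, add_zero] at h
  zify
  push_cast
  omega

lemma summable_ratio (g r : ℕ → ℂ) (L : ℂ) (hg : ∀ n, g (n + 1) = g n * r n)
    (hr : Tendsto r atTop (𝓝 L)) (hL : ‖L‖ < 1) : Summable g := by
  obtain ⟨s, hs1, hs2⟩ := exists_between hL
  refine summable_of_ratio_norm_eventually_le (r := s) hs2 ?_
  filter_upwards [hr.norm.eventually_le_const hs1] with n hn
  rw [hg, norm_mul, mul_comm]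
  gcongr

/-- The general term of theta. -/
noncomputable def cc (q z : ℂ) (n : ℤ) : ℂ := q ^ (n * (n - 1) / 2) * z ^ n

lemma cc_add (q z : ℂ) (hq : q ≠ 0) (hz : z ≠ 0) (m n : ℤ) :
    cc q z (m + n) = cc q z m * cc q z n * q ^ (m * n) := by
  unfold cc
  rw [tri_add, zpow_add₀ hq, zpow_add₀ hq, zpow_add₀ hz]
  ring

lemma cc_ne (q z : ℂ) (hq : q ≠ 0) (hz : z ≠ 0) (n : ℤ) : cc q z n ≠ 0 :=
  mul_ne_zero (zpow_ne_zero _ hq) (zpow_ne_zero _ hz)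

lemma pow_tendsto (q : ℂ) (hq1 : ‖q‖ < 1) : Tendsto (fun n : ℕ => q ^ n) atTop (𝓝 0) :=
  tendsto_pow_atTop_nhds_zero_of_norm_lt_one hq1

lemma cc_summable (q z : ℂ) (hq : q ≠ 0) (hq1 : ‖q‖ < 1) (hz : z ≠ 0) : Summable (cc q z) := by
  apply Summable.of_nat_of_neg
  · refine summable_ratio _ (fun n => cc q z 1 * q ^ n) 0 ?_ ?_ (by simp)
    · intro n
      push_cast
      rw [cc_add q z hq hz, mul_one, zpow_natCast]
      ring
    · simpa using (pow_tendsto q hq1).const_mul (cc q z 1)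
  · refine summable_ratio _ (fun n => cc q z (-1) * q ^ n) 0 ?_ ?_ (by simp)
    · intro n
      push_cast
      rw [neg_add, cc_add q z hq hz, neg_mul_neg, mul_one, zpow_natCast]
      ring
    · simpa using (pow_tendsto q hq1).const_mul (cc q z (-1))

lemma theta_shift (q z : ℂ) (hq : q ≠ 0) (hz : z ≠ 0) (j : ℤ) :
    thetaQ q z = cc q z j * thetaQ q (z * q ^ j) := by
  have h : thetaQ q z = ∑' n : ℤ, cc q z n := rfl
  rw [h, ← (Equiv.addLeft j).tsum_eq, thetaQ, ← tsum_mul_left]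
  congr 1
  ext n
  simp only [Equiv.coe_addLeft]
  rw [cc_add q z hq hz, mul_zpow, ← zpow_mul]
  simp only [cc]
  ring

def shiftE : ℤ × ℕ ≃ ℤ × ℕ where
  toFun p := (p.1 + p.2, p.2)
  invFun p := (p.1 - p.2, p.2)
  left_inv p := by simp
  right_inv p := by simp

lemma key_term (q z x b : ℂ) (hq : q ≠ 0) (hz : z ≠ 0) (n : ℤ) (k : ℕ) :
    cc q z (n + k) * (b * x ^ k)
      = (b * q ^ (k * (k - 1) / 2) * (z * x * q ^ n) ^ k) * cc q z n := by
  rw [cc_add q z hq hz, mul_pow, mul_pow, ← zpow_natCast (q ^ n), ← zpow_mul,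
    ← zpow_natCast q (k * (k - 1) / 2), tri_nat]
  simp only [cc, zpow_natCast]
  ring

/-- The double series rearrangement. -/
lemma key (q z x : ℂ) (a : ℕ → ℂ) (hq : q ≠ 0) (hq1 : ‖q‖ < 1) (hz : z ≠ 0)
    (ha : Summable fun k => a k * x ^ k) :
    HasSum (fun n : ℤ => (∑' k : ℕ, a k * q ^ (k * (k - 1) / 2) * (z * x * q ^ n) ^ k) * cc q z n)
      ((∑' k : ℕ, a k * x ^ k) * thetaQ q z) := by
  have hc := cc_summable q z hq hq1 hz
  have hs : Summable fun p : ℤ × ℕ => cc q z p.1 * (a p.2 * x ^ p.2) :=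
    summable_mul_of_summable_norm (f := cc q z) (g := fun k => a k * x ^ k)
      (summable_norm_iff.2 hc) (summable_norm_iff.2 ha)
  have hp : HasSum (fun p : ℤ × ℕ => cc q z p.1 * (a p.2 * x ^ p.2))
      (thetaQ q z * ∑' k : ℕ, a k * x ^ k) :=
    HasSum.mul (f := cc q z) (g := fun k => a k * x ^ k) hc.hasSum ha.hasSum hs
  have hp2 := (shiftE.hasSum_iff).2 hp
  have hfun : ((fun p : ℤ × ℕ => cc q z p.1 * (a p.2 * x ^ p.2)) ∘ shiftE) = fun p : ℤ × ℕ =>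
      (a p.2 * q ^ (p.2 * (p.2 - 1) / 2) * (z * x * q ^ p.1) ^ p.2) * cc q z p.1 := by
    funext p
    obtain ⟨n, k⟩ := p
    exact key_term q z x (a k) hq hz n k
  rw [hfun] at hp2
  have hfib := hp2.prod_fiberwise (fun n => (hp2.summable.prod_factor n).hasSum)
  rw [mul_comm (thetaQ q z)] at hfib
  simp only [tsum_mul_right] at hfib
  exact hfib

/-- reciprocal of (q;q)_n -/
noncomputable def dd (q : ℂ) (n : ℕ) : ℂ := ∏ k ∈ Finset.range n, (1 - q ^ (k + 1))⁻¹

lemma one_sub_ne (q : ℂ) (hq1 : ‖q‖ < 1) (k : ℕ) : 1 - q ^ (k + 1) ≠ 0 := by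
  intro h
  have h1 : q ^ (k + 1) = 1 := (sub_eq_zero.1 h).symm
  have h2 : ‖q‖ ^ (k + 1) < 1 := pow_lt_one₀ (norm_nonneg _) hq1 (by omega)
  rw [← norm_pow, h1] at h2
  simp at h2

lemma dd_succ (q : ℂ) (n : ℕ) : dd q (n + 1) = dd q n * (1 - q ^ (n + 1))⁻¹ :=
  Finset.prod_range_succ _ _

lemma dd_succ_mul (q : ℂ) (hq1 : ‖q‖ < 1) (n : ℕ) : dd q (n + 1) * (1 - q ^ (n + 1)) = dd q n := by
  rw [dd_succ, mul_assoc, inv_mul_cancel₀ (one_sub_ne q hq1 n), mul_one]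

lemma inv_tendsto (q : ℂ) (hq1 : ‖q‖ < 1) :
    Tendsto (fun n : ℕ => (1 - q ^ (n + 1))⁻¹) atTop (𝓝 1) := by
  have h := ((pow_tendsto q hq1).comp (tendsto_add_atTop_nat 1)).const_sub 1
  have h2 := h.inv₀ (by simp)
  simpa using h2

noncomputable def ee (q w : ℂ) (n : ℕ) : ℂ := dd q n * q ^ (n * (n - 1) / 2) * w ^ n

noncomputable def EE (q w : ℂ) : ℂ := ∑' n, ee q w n

lemma dd_summable (q x : ℂ) (hq1 : ‖q‖ < 1) (hx : ‖x‖ < 1) : Summable fun n => dd q n * x ^ n := by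
  refine summable_ratio _ (fun n => (1 - q ^ (n + 1))⁻¹ * x) x ?_ ?_ hx
  · intro n
    rw [dd_succ]
    ring
  · simpa using (inv_tendsto q hq1).mul_const x

lemma ee_summable (q w : ℂ) (hq1 : ‖q‖ < 1) : Summable (ee q w) := by
  refine summable_ratio _ (fun n => (1 - q ^ (n + 1))⁻¹ * (q ^ n * w)) 0 ?_ ?_ (by simp)
  · intro n
    simp only [ee]
    rw [dd_succ, tri_succ]
    ring
  · simpa using (inv_tendsto q hq1).mul ((pow_tendsto q hq1).mul_const w)

lemma EE_step (q w : ℂ) (hq1 : ‖q‖ < 1) : EE q w = (1 + w) * EE q (w * q) := by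
  have h1 := ee_summable q w hq1
  have h2 := ee_summable q (w * q) hq1
  have h3 : EE q w - EE q (w * q) = w * EE q (w * q) := by
    unfold EE
    rw [← h1.tsum_sub h2, (h1.sub h2).tsum_eq_zero_add, ← tsum_mul_left]
    have : ee q w 0 - ee q (w * q) 0 = 0 := by simp [ee]
    rw [this, zero_add]
    congr 1
    ext n
    simp only [ee]
    rw [tri_succ, ← dd_succ_mul q hq1 n]
    ring
  linear_combination h3

lemma EE_iter (q w : ℂ) (hq1 : ‖q‖ < 1) (h : EE q w = 0) (hw : ∀ k : ℕ, 1 + w * q ^ k ≠ 0) (N : ℕ) :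
    EE q (w * q ^ N) = 0 := by
  induction N with
  | zero => simpa using h
  | succ N ih =>
    rw [EE_step q _ hq1] at ih
    rw [pow_succ, ← mul_assoc]
    exact (mul_eq_zero.1 ih).resolve_left (hw N)

lemma EE_ne (q w : ℂ) (hq1 : ‖q‖ < 1) (hw : ∀ k : ℕ, 1 + w * q ^ k ≠ 0) : EE q w ≠ 0 := by
  intro h
  have h0 := EE_iter q w hq1 h hw
  have hlim : Tendsto (fun N : ℕ => EE q (w * q ^ N)) atTop (𝓝 (EE q 0)) := by
    unfold EE
    refine tendsto_tsum_of_dominated_convergence (bound := fun n => ‖ee q w n‖)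
      (ee_summable q w hq1).norm ?_ ?_
    · intro n
      unfold ee
      have := (pow_tendsto q hq1).const_mul w
      rw [mul_zero] at this
      exact (this.pow n).const_mul _
    · refine Eventually.of_forall fun N n => ?_
      simp only [ee, norm_mul, norm_pow]
      gcongr
      have : ‖q‖ ^ N ≤ 1 := pow_le_one₀ (norm_nonneg _) hq1.le
      nlinarith [norm_nonneg w]
  have h1 : EE q 0 = 1 := by
    unfold EE
    rw [tsum_eq_single 0]
    · simp [ee, dd]
    · intro n hn
      simp [ee, hn]
  simp only [h0, h1] at hlim
  exact zero_ne_one (tendsto_nhds_unique tendsto_const_nhds hlim)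

lemma EE_neg (q : ℂ) (hq : q ≠ 0) (hq1 : ‖q‖ < 1) (j : ℕ) : EE q (-(q ^ j)⁻¹) = 0 := by
  induction j with
  | zero => rw [EE_step q _ hq1]; simp
  | succ j ih =>
    rw [EE_step q _ hq1]
    have : -(q ^ (j + 1))⁻¹ * q = -(q ^ j)⁻¹ := by
      field_simp
      ring
    rw [this, ih, mul_zero]

lemma EE_pos (q : ℂ) (hq1 : ‖q‖ < 1) (n : ℕ) : EE q (-q ^ (n + 1)) = EE q (-q) * dd q n := by
  induction n with
  | zero => simp [dd]
  | succ n ih =>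
    rw [EE_step q _ hq1] at ih
    have h := one_sub_ne q hq1 n
    rw [dd_succ, ← mul_assoc, ← ih]
    have : -q ^ (n + 1) * q = -q ^ (n + 1 + 1) := by ring
    rw [this]
    field_simp
    ring

lemma theta_ne_large (q w : ℂ) (hq : q ≠ 0) (hq1 : ‖q‖ < 1) (hw : 1 < ‖w‖)
    (hwk : ∀ k : ℕ, 1 + w * q ^ k ≠ 0) : thetaQ q w ≠ 0 := by
  intro h
  have hw0 : w ≠ 0 := by
    rintro rfl
    simp at hw
    linarith
  have hx : ‖-q * w⁻¹‖ < 1 := by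
    rw [norm_mul, norm_neg, norm_inv]
    have : ‖w‖⁻¹ < 1 := inv_lt_one_of_one_lt₀ hw
    have : 0 < ‖w‖⁻¹ := by positivity
    nlinarith [norm_nonneg q]
  have hs := dd_summable q (-q * w⁻¹) hq1 hx
  have hk := key q w (-q * w⁻¹) (dd q) hq hq1 hw0 hs
  rw [h, mul_zero] at hk
  have hzx : w * (-q * w⁻¹) = -q := by field_simp
  simp only [hzx] at hk
  change HasSum (fun n : ℤ => EE q (-q * q ^ n) * cc q w n) 0 at hk
  have hinj : Function.Injective (fun n : ℕ => (n : ℤ)) := Nat.cast_injective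
  rw [← hinj.hasSum_iff] at hk
  · have h2 : HasSum (fun n : ℕ => EE q (-q) * ee q w n) 0 := by
      convert hk using 2 with n
      simp only [Function.comp]
      have : -q * q ^ (n : ℤ) = -q ^ (n + 1) := by rw [zpow_natCast]; ring
      rw [this, EE_pos q hq1]
      simp only [ee, cc]
      rw [← tri_nat, zpow_natCast, zpow_natCast]
      ring
    have h3 := h2.tsum_eq
    rw [tsum_mul_left] at h3
    rcases mul_eq_zero.1 h3 with h4 | h4
    · refine EE_ne q (-q) hq1 (fun k hk => ?_) h4
      apply one_sub_ne q hq1 k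
      rw [← hk]
      ring
    · exact EE_ne q w hq1 hwk h4
  · intro n hn
    have hn0 : n < 0 := by
      by_contra! hc
      exact hn ⟨n.toNat, by simp [hc]⟩
    obtain ⟨j, rfl⟩ : ∃ j : ℕ, n = -((j : ℤ) + 1) := ⟨(-n - 1).toNat, by omega⟩
    have : -q * q ^ (-((j : ℤ) + 1)) = -(q ^ j)⁻¹ := by
      rw [neg_add, zpow_add₀ hq, zpow_neg, zpow_natCast]
      field_simp
    rw [this, EE_neg q hq hq1, zero_mul]

lemma theta_ne (q z : ℂ) (hq : q ≠ 0) (hq1 : ‖q‖ < 1) (hz : z ≠ 0)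
    (hzk : ∀ m : ℤ, 1 + z * q ^ m ≠ 0) : thetaQ q z ≠ 0 := by
  have hqn : 0 < ‖q‖ := norm_pos_iff.2 hq
  have hzn : 0 < ‖z‖ := norm_pos_iff.2 hz
  obtain ⟨j, hj⟩ := exists_pow_lt_of_lt_one hzn hq1
  rw [theta_shift q z hq hz (-j)]
  refine mul_ne_zero (cc_ne q z hq hz _) (theta_ne_large q _ hq hq1 ?_ ?_)
  · rw [norm_mul, zpow_neg, zpow_natCast, norm_inv, norm_pow, ← div_eq_mul_inv]
    rwa [one_lt_div (by positivity)]
  · intro k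
    rw [mul_assoc, ← zpow_natCast, ← zpow_add₀ hq]
    exact hzk _

theorem stmt_17 (q lam : ℂ) (a : ℕ → ℂ) (R : ℝ)
    (hq0 : 0 < ‖q‖) (hq1 : ‖q‖ < 1)
    (hlam : lam ≠ 0) (hR : 0 < R)
    (hconv : ∀ y : ℂ, ‖y‖ < R → Summable fun k : ℕ => a k * y ^ k)
    (x : ℂ) (hx0 : 0 < ‖x‖) (hxR : ‖x‖ < R)
    (hxl : ∀ m : ℤ, x ≠ -(lam * q ^ m)) :
    HasSum
      (fun n : ℤ =>
        (∑' k : ℕ, a k * q ^ (k * (k - 1) / 2) * (lam * q ^ n) ^ k) /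
          thetaQ q (lam * q ^ n / x))
      (∑' k : ℕ, a k * x ^ k) := by
  have hq : q ≠ 0 := norm_pos_iff.1 hq0
  have hx : x ≠ 0 := norm_pos_iff.1 hx0
  have hz : lam / x ≠ 0 := div_ne_zero hlam hx
  have hth : thetaQ q (lam / x) ≠ 0 := by
    refine theta_ne q _ hq hq1 hz fun m h => hxl m ?_
    field_simp at h
    linear_combination h
  have hk := (key q (lam / x) x a hq hq1 hz (hconv x hxR)).div_const (thetaQ q (lam / x))
  rw [mul_div_cancel_right₀ _ hth] at hk
  refine (congrArg (fun f => HasSum f (∑' k : ℕ, a k * x ^ k)) (funext fun n => ?_)).mpr hk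
  rw [div_mul_cancel₀ _ hx, theta_shift q (lam / x) hq hz n]
  have hc := cc_ne q (lam / x) hq hz n
  have : lam * q ^ n / x = lam / x * q ^ n := by ring
  rw [this, mul_comm (cc q (lam / x) n), mul_div_mul_right _ _ hc]
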